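/- Assume X is a polyhedron, the functions {x ↦ exp(αᵀx)}_{α∈𝒜} are linearly independent on X, and Λ_X(𝒜) is nonempty. Then for every proper subset Λ ⊊ Λ*_X(𝒜) of the reduced normalized X-circuits, the Minkowski sum Σ_{λ ∈ Λ} C_X(𝒜,λ) is a proper subset of C_X(𝒜); i.e., no proper subfamily of the reduced circuits suffices to generate the X-SAGE cone. -/

import Mathlib

open Finset

/-- Dot product on `Fin n → ℝ`. -/
noncomputable def dotp {n : ℕ} (y x : Fin n → ℝ) : ℝ := ∑ i, y i * x i

/-- Support function `σ_X : ℝⁿ → ℝ ∪ {±∞}` of a set `X ⊆ ℝⁿ`. -/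
noncomputable def suppFn {n : ℕ} (X : Set (Fin n → ℝ)) (y : Fin n → ℝ) : EReal :=
  ⨆ x ∈ X, ((dotp y x : ℝ) : EReal)

/-- The linear map `𝒜 : ℝ^𝒜 → ℝⁿ`, `ν ↦ Σ_α ν_α α`. -/
noncomputable def Amap {n m : ℕ} (A : Fin m → Fin n → ℝ) (ν : Fin m → ℝ) : Fin n → ℝ :=
  fun j => ∑ i, ν i * A i j

/-- `N_β = {ν : ν_α ≥ 0 (α ≠ β), Σ ν_α = 0}`. -/
def Nbeta {m : ℕ} (b : Fin m) : Set (Fin m → ℝ) :=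
  {ν | (∀ i, i ≠ b → 0 ≤ ν i) ∧ ∑ i, ν i = 0}

/-- Two vectors are proportional if one is a scalar multiple of the other. -/
def Proportional {m : ℕ} (u v : Fin m → ℝ) : Prop :=
  ∃ t : ℝ, u = t • v ∨ v = t • u

/-- The augmented support function `ν ↦ σ_X(-𝒜ν)`. -/
noncomputable def sigA {n m : ℕ} (X : Set (Fin n → ℝ)) (A : Fin m → Fin n → ℝ)
    (ν : Fin m → ℝ) : EReal :=
  suppFn X (-(Amap A ν))

/-- The map `ν ↦ σ_X(-𝒜ν)` is affine on the segment `[ν1, ν2]`. -/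
def SigmaAffineOnSeg {n m : ℕ} (X : Set (Fin n → ℝ)) (A : Fin m → Fin n → ℝ)
    (ν1 ν2 : Fin m → ℝ) : Prop :=
  ∀ t : ℝ, t ∈ Set.Icc (0:ℝ) 1 →
    sigA X A (t • ν1 + (1 - t) • ν2) =
      (t : EReal) * sigA X A ν1 + ((1 - t : ℝ) : EReal) * sigA X A ν2

/-- `ν` is an `X`-circuit of `𝒜` (with negative index allowed only at `b`). -/
def IsXCircuit {n m : ℕ} (X : Set (Fin n → ℝ)) (A : Fin m → Fin n → ℝ)
    (b : Fin m) (ν : Fin m → ℝ) : Prop :=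
  ν ∈ Nbeta b ∧ ν ≠ 0 ∧ sigA X A ν < ⊤ ∧
  ¬ ∃ (ν1 ν2 : Fin m → ℝ) (θ : ℝ), ν1 ∈ Nbeta b ∧ ν2 ∈ Nbeta b ∧
      ¬ Proportional ν1 ν2 ∧ θ ∈ Set.Ioo (0:ℝ) 1 ∧
      ν = θ • ν1 + (1 - θ) • ν2 ∧ SigmaAffineOnSeg X A ν1 ν2

/-- All finite nonnegative combinations of elements of `S` (including `0`). -/
def coneHull {E : Type*} [AddCommMonoid E] [SMul ℝ E] (S : Set E) : Set E :=
  {x | ∃ (k : ℕ) (t : Fin k → ℝ) (v : Fin k → E),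
    (∀ j, 0 ≤ t j) ∧ (∀ j, v j ∈ S) ∧ x = ∑ j, t j • v j}

/-- `v` is an edge generator of the convex cone `K`. -/
def IsEdgeGenerator {E : Type*} [AddCommMonoid E] [SMul ℝ E] (K : Set E) (v : E) : Prop :=
  v ≠ 0 ∧ v ∈ K ∧ ∀ u ∈ K, ∀ w ∈ K, v = u + w →
    (∃ a : ℝ, 0 ≤ a ∧ u = a • v) ∧ (∃ b : ℝ, 0 ≤ b ∧ w = b • v)

/-- The `X`-AGE cone `C_X(𝒜, β)`, as a cone of coefficient vectors. -/
def AgeCone {n m : ℕ} (X : Set (Fin n → ℝ)) (A : Fin m → Fin n → ℝ) (b : Fin m) :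
    Set (Fin m → ℝ) :=
  {c | (∀ i, i ≠ b → 0 ≤ c i) ∧ ∀ x ∈ X, 0 ≤ ∑ i, c i * Real.exp (dotp (A i) x)}

/-- The `X`-SAGE cone `C_X(𝒜) = Σ_β C_X(𝒜, β)`. -/
def Sage {n m : ℕ} (X : Set (Fin n → ℝ)) (A : Fin m → Fin n → ℝ) : Set (Fin m → ℝ) :=
  {c | ∃ f : Fin m → (Fin m → ℝ), (∀ b, f b ∈ AgeCone X A b) ∧ c = ∑ b, f b}

/-- One summand of the relative entropy, with the conventions `0·log 0 = 0` and
`D = ∞` if `a > 0` while `c ≤ 0`. -/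
noncomputable def relEnt (a c : ℝ) : EReal :=
  if a = 0 then 0 else if 0 < c then ((a * Real.log (a / c) : ℝ) : EReal) else ⊤

/-- The relative entropy `D(ν_{∖β}, e · c_{∖β})`. -/
noncomputable def relEntSum {m : ℕ} (b : Fin m) (ν c : Fin m → ℝ) : EReal :=
  ∑ i ∈ Finset.univ.erase b, relEnt (ν i) (Real.exp 1 * c i)

/-- Condition (★): `ν ∈ N_β`, `ν ≠ 0`, `σ_X(-𝒜ν) + D(ν_{∖β}, e c_{∖β}) ≤ c_β`. -/
def StarCond {n m : ℕ} (X : Set (Fin n → ℝ)) (A : Fin m → Fin n → ℝ)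
    (b : Fin m) (c ν : Fin m → ℝ) : Prop :=
  ν ∈ Nbeta b ∧ ν ≠ 0 ∧ sigA X A ν + relEntSum b ν c ≤ (c b : EReal)

/-- The `λ`-witnessed AGE cone `C_X(𝒜, λ)` for a normalized `λ` with `λ_β = -1`. -/
noncomputable def WitnessCone {n m : ℕ} (X : Set (Fin n → ℝ)) (A : Fin m → Fin n → ℝ)
    (b : Fin m) (l : Fin m → ℝ) : Set (Fin m → ℝ) :=
  {c | (∀ i, i ≠ b → 0 ≤ c i) ∧
    (-(c b)) * Real.exp ((sigA X A l).toReal) ≤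
      ∏ i ∈ Finset.univ.filter (fun i => 0 < l i), (c i / l i) ^ (l i)}

/-- Normalized `X`-circuits in `N_β`. -/
def LambdaB {n m : ℕ} (X : Set (Fin n → ℝ)) (A : Fin m → Fin n → ℝ) (b : Fin m) :
    Set (Fin m → ℝ) :=
  {l | IsXCircuit X A b l ∧ l b = -1}

/-- All normalized `X`-circuits of `𝒜`. -/
def Lambda {n m : ℕ} (X : Set (Fin n → ℝ)) (A : Fin m → Fin n → ℝ) : Set (Fin m → ℝ) :=
  ⋃ b, LambdaB X A b

/-- Functional form `φ_λ = (λ, σ_X(-𝒜λ)) ∈ ℝ^𝒜 × ℝ`. -/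
noncomputable def phiVec {n m : ℕ} (X : Set (Fin n → ℝ)) (A : Fin m → Fin n → ℝ)
    (l : Fin m → ℝ) : (Fin m → ℝ) × ℝ :=
  (l, (sigA X A l).toReal)

/-- Functional form as an affine function `φ_λ(y) = Σ y_α λ_α + σ_X(-𝒜λ)`. -/
noncomputable def phiFun {n m : ℕ} (X : Set (Fin n → ℝ)) (A : Fin m → Fin n → ℝ)
    (l : Fin m → ℝ) (y : Fin m → ℝ) : ℝ :=
  (∑ i, y i * l i) + (sigA X A l).toReal

/-- The circuit graph `G_X(𝒜)`. -/
noncomputable def circuitGraph {n m : ℕ} (X : Set (Fin n → ℝ)) (A : Fin m → Fin n → ℝ) :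
    Set ((Fin m → ℝ) × ℝ) :=
  coneHull ((phiVec X A '' Lambda X A) ∪ {((0 : Fin m → ℝ), (1 : ℝ))})

/-- The reduced normalized `X`-circuits `Λ*_X(𝒜)`. -/
noncomputable def LambdaStar {n m : ℕ} (X : Set (Fin n → ℝ)) (A : Fin m → Fin n → ℝ) :
    Set (Fin m → ℝ) :=
  {l | l ∈ Lambda X A ∧ IsEdgeGenerator (circuitGraph X A) (phiVec X A l)}

/-- `λ`-witnessed AGE cone for a normalized circuit, with `β` recovered from `λ`. -/
noncomputable def WitnessConeL {n m : ℕ} (X : Set (Fin n → ℝ)) (A : Fin m → Fin n → ℝ)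
    (l : Fin m → ℝ) : Set (Fin m → ℝ) :=
  ⋃ b ∈ {b : Fin m | l b = -1}, WitnessCone X A b l

/-- Dual cone of a set of coefficient vectors in `ℝ^𝒜`. -/
def dualConeV {m : ℕ} (K : Set (Fin m → ℝ)) : Set (Fin m → ℝ) :=
  {v | ∀ c ∈ K, 0 ≤ ∑ i, v i * c i}

/-- Dual cone of a subset of `ℝ^𝒜 × ℝ`. -/
def dualConeP {m : ℕ} (K : Set ((Fin m → ℝ) × ℝ)) : Set ((Fin m → ℝ) × ℝ) :=
  {p | ∀ q ∈ K, 0 ≤ (∑ i, p.1 i * q.1 i) + p.2 * q.2}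

/-- The basis functions `x ↦ exp(αᵀx)`, `α ∈ 𝒜`, are linearly independent on `X`. -/
def ExpLinIndep {n m : ℕ} (X : Set (Fin n → ℝ)) (A : Fin m → Fin n → ℝ) : Prop :=
  LinearIndependent ℝ (fun i : Fin m => fun x : X => Real.exp (dotp (A i) (x : Fin n → ℝ)))

/-- `X` is a polyhedron: an intersection of finitely many closed halfspaces. -/
def IsPolyhedron {n : ℕ} (X : Set (Fin n → ℝ)) : Prop :=
  ∃ (k : ℕ) (a : Fin k → Fin n → ℝ) (bb : Fin k → ℝ),
    X = {x | ∀ i, dotp (a i) x ≤ bb i}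

/-- Minkowski sum `Σ_{l ∈ Λ} C(l)` (finite sums, one summand per `l`;
the empty sum gives `{0}`). -/
def MinkSumOver {m : ℕ} (Λ : Set (Fin m → ℝ)) (C : (Fin m → ℝ) → Set (Fin m → ℝ)) :
    Set (Fin m → ℝ) :=
  {c | ∃ (s : Finset (Fin m → ℝ)) (f : (Fin m → ℝ) → (Fin m → ℝ)),
    (↑s ⊆ Λ) ∧ (∀ l ∈ s, f l ∈ C l) ∧ c = ∑ l ∈ s, f l}

/-! ### The Farkas lemma -/

/-- **The Farkas lemma**: a linear functional that is nonnegative wherever finitely many given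
functionals are nonnegative is a nonnegative combination of them. -/
theorem exists_nonneg_combination_of_forall_nonneg {V ι : Type*} [AddCommGroup V] [Module ℝ V]
    [DecidableEq ι] (s : Finset ι) (f : ι → V →ₗ[ℝ] ℝ) (g : V →ₗ[ℝ] ℝ)
    (h : ∀ x, (∀ i ∈ s, 0 ≤ f i x) → 0 ≤ g x) :
    ∃ t : ι → ℝ, (∀ i, 0 ≤ t i) ∧ ∀ x, g x = ∑ i ∈ s, t i * f i x := by
  induction s using Finset.induction_on generalizing f g with
  | empty =>
    refine ⟨0, fun i => le_rfl, fun x => ?_⟩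
    have h1 := h x (by simp)
    have h2 := h (-x) (by simp)
    rw [map_neg] at h2
    simp only [Finset.sum_empty]
    linarith
  | insert a s ha ih =>
    by_cases hs : ∀ x, (∀ i ∈ s, 0 ≤ f i x) → 0 ≤ g x
    · obtain ⟨t, ht, hg⟩ := ih f g hs
      refine ⟨fun i => if i = a then 0 else t i, fun i => ?_, fun x => ?_⟩
      · dsimp only
        split_ifs
        exacts [le_rfl, ht i]
      · rw [Finset.sum_insert ha, hg]
        simp only [if_true, zero_mul, zero_add]
        refine Finset.sum_congr rfl fun i hi => ?_
        rw [if_neg (ne_of_mem_of_not_mem hi ha)]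
    · push Not at hs
      obtain ⟨x₁, hx₁, hgx₁⟩ := hs
      have hfa : f a x₁ < 0 := by
        by_contra! hfa
        refine absurd (h x₁ fun i hi => ?_) (not_le.2 hgx₁)
        rcases Finset.mem_insert.1 hi with rfl | hi
        exacts [hfa, hx₁ i hi]
      obtain ⟨x₀, hx₀, hgx₀, hfa₀⟩ : ∃ x₀, (∀ i ∈ s, 0 ≤ f i x₀) ∧ g x₀ < 0 ∧ f a x₀ = -1 := by
        have hc : 0 < -(f a x₁)⁻¹ := neg_pos.2 (inv_lt_zero.2 hfa)
        refine ⟨(-(f a x₁)⁻¹) • x₁, fun i hi => ?_, ?_, ?_⟩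
        · rw [map_smul, smul_eq_mul]
          exact mul_nonneg hc.le (hx₁ i hi)
        · rw [map_smul, smul_eq_mul]
          exact mul_neg_of_pos_of_neg hc hgx₁
        · rw [map_smul, smul_eq_mul]
          field_simp [hfa.ne]
      obtain ⟨t, ht, hg⟩ := ih (fun i => f i + f i x₀ • f a) (g + g x₀ • f a) (by
        intro x hx
        have := h (x + f a x • x₀) (by
          intro i hi
          rcases Finset.mem_insert.1 hi with rfl | hi
          · simp [hfa₀]
          · have := hx i hi
            simp only [LinearMap.add_apply, LinearMap.smul_apply, smul_eq_mul, map_add,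
              map_smul] at this ⊢
            linarith)
        simp only [LinearMap.add_apply, LinearMap.smul_apply, smul_eq_mul, map_add,
          map_smul] at this ⊢
        linarith)
      refine ⟨fun i => if i = a then (∑ i ∈ s, t i * f i x₀) - g x₀ else t i,
        fun i => ?_, fun x => ?_⟩
      · dsimp only
        split_ifs
        · have : 0 ≤ ∑ i ∈ s, t i * f i x₀ :=
            Finset.sum_nonneg fun i hi => mul_nonneg (ht i) (hx₀ i hi)
          linarith
        · exact ht i
      · have hrest : ∑ i ∈ s, (if i = a then (∑ i ∈ s, t i * f i x₀) - g x₀ else t i) * f i x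
            = ∑ i ∈ s, t i * f i x :=
          Finset.sum_congr rfl fun i hi => by rw [if_neg (ne_of_mem_of_not_mem hi ha)]
        rw [Finset.sum_insert ha, hrest]
        simp only [if_true]
        have := hg x
        simp only [LinearMap.add_apply, LinearMap.smul_apply, smul_eq_mul, mul_add,
          Finset.sum_add_distrib] at this
        have h2 : ∑ i ∈ s, t i * (f i x₀ * f a x) = (∑ i ∈ s, t i * f i x₀) * f a x := by
          rw [Finset.sum_mul]
          exact Finset.sum_congr rfl fun i _ => by ring
        rw [h2] at this
        linarith

/-- Pairing with a fixed element of `ℝ^d × ℝ`, as a linear functional. -/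
noncomputable def pairing {d : ℕ} (p : (Fin d → ℝ) × ℝ) : ((Fin d → ℝ) × ℝ) →ₗ[ℝ] ℝ where
  toFun y := (∑ i, y.1 i * p.1 i) + y.2 * p.2
  map_add' y z := by
    simp only [Prod.fst_add, Prod.snd_add, Pi.add_apply, add_mul, Finset.sum_add_distrib]
    ring
  map_smul' c y := by
    simp only [Prod.smul_fst, Prod.smul_snd, Pi.smul_apply, smul_eq_mul, mul_assoc, mul_add,
      Finset.mul_sum, RingHom.id_apply]

theorem pairing_apply {d : ℕ} (p y : (Fin d → ℝ) × ℝ) :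
    pairing p y = (∑ i, y.1 i * p.1 i) + y.2 * p.2 := rfl

theorem exists_nonneg_combination_vec {d : ℕ} {ι : Type*} [Fintype ι]
    (p : ι → (Fin d → ℝ) × ℝ) (q : (Fin d → ℝ) × ℝ)
    (h : ∀ y, (∀ i, 0 ≤ pairing (p i) y) → 0 ≤ pairing q y) :
    ∃ t : ι → ℝ, (∀ i, 0 ≤ t i) ∧ q = ∑ i, t i • p i := by
  classical
  obtain ⟨t, ht, hg⟩ := exists_nonneg_combination_of_forall_nonneg Finset.univ
    (fun i => pairing (p i)) (pairing q) (fun y hy => h y fun i => hy i (Finset.mem_univ i))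
  refine ⟨t, ht, Prod.ext (funext fun j => ?_) ?_⟩
  · have := hg (Pi.single j 1, 0)
    simpa [pairing_apply, Pi.single_apply, Prod.fst_sum] using this
  · have := hg (0, 1)
    simpa [pairing_apply, Prod.snd_sum] using this

/-! ### The support function -/

theorem dotp_Amap {n m : ℕ} (A : Fin m → Fin n → ℝ) (ν : Fin m → ℝ) (x : Fin n → ℝ) :
    dotp (-(Amap A ν)) x = -∑ i, ν i * dotp (A i) x := by
  simp only [dotp, Amap, Pi.neg_apply, neg_mul, Finset.sum_neg_distrib, Finset.sum_mul,
    Finset.mul_sum]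
  rw [Finset.sum_comm]
  simp only [mul_assoc]

theorem sigA_le_iff {n m : ℕ} {X : Set (Fin n → ℝ)} {A : Fin m → Fin n → ℝ} {ν : Fin m → ℝ}
    {r : ℝ} : sigA X A ν ≤ r ↔ ∀ x ∈ X, -∑ i, ν i * dotp (A i) x ≤ r := by
  simp only [sigA, suppFn, iSup_le_iff, EReal.coe_le_coe_iff, dotp_Amap]

theorem coe_toReal_sigA {n m : ℕ} {X : Set (Fin n → ℝ)} (hX : X.Nonempty)
    {A : Fin m → Fin n → ℝ} {ν : Fin m → ℝ} (h : sigA X A ν < ⊤) :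
    ((sigA X A ν).toReal : EReal) = sigA X A ν := by
  refine EReal.coe_toReal h.ne fun hbot => ?_
  obtain ⟨x, hx⟩ := hX
  have : ((dotp (-(Amap A ν)) x : ℝ) : EReal) ≤ sigA X A ν :=
    le_iSup₂ (f := fun x (_ : x ∈ X) => ((dotp (-(Amap A ν)) x : ℝ) : EReal)) x hx
  rw [hbot] at this
  exact EReal.coe_ne_bot _ (le_bot_iff.1 this)

theorem exists_sigA_eq_coe {n m : ℕ} {X : Set (Fin n → ℝ)} (hX : X.Nonempty)
    {A : Fin m → Fin n → ℝ} {ν : Fin m → ℝ} {r : ℝ} (h : sigA X A ν ≤ r) :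
    ∃ c : ℝ, sigA X A ν = c :=
  ⟨_, (coe_toReal_sigA hX (h.trans_lt (EReal.coe_lt_top r))).symm⟩

theorem sigA_combination_le {n m : ℕ} {X : Set (Fin n → ℝ)} {A : Fin m → Fin n → ℝ}
    {u w : Fin m → ℝ} {p q s t : ℝ} (hu : sigA X A u ≤ p) (hw : sigA X A w ≤ q)
    (hs : 0 ≤ s) (ht : 0 ≤ t) : sigA X A (s • u + t • w) ≤ ((s * p + t * q : ℝ) : EReal) := by
  rw [sigA_le_iff] at *
  intro x hx
  have h1 := mul_le_mul_of_nonneg_left (hu x hx) hs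
  have h2 := mul_le_mul_of_nonneg_left (hw x hx) ht
  have : ∑ i, (s • u + t • w) i * dotp (A i) x
      = s * ∑ i, u i * dotp (A i) x + t * ∑ i, w i * dotp (A i) x := by
    simp only [Pi.add_apply, Pi.smul_apply, smul_eq_mul, add_mul, Finset.sum_add_distrib,
      Finset.mul_sum, mul_assoc]
  rw [this]
  linarith

/-- Strong duality for the support function of a nonempty polyhedron. -/
theorem exists_dual_certificate {n m k : ℕ} (a : Fin k → Fin n → ℝ) (β : Fin k → ℝ)
    (hX : {x | ∀ i, dotp (a i) x ≤ β i}.Nonempty) (A : Fin m → Fin n → ℝ) (ν : Fin m → ℝ) (r : ℝ)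
    (h : sigA {x | ∀ i, dotp (a i) x ≤ β i} A ν ≤ r) :
    ∃ μ : Fin k → ℝ, (∀ i, 0 ≤ μ i) ∧ (∀ j, ∑ i, μ i * a i j = -(Amap A ν) j) ∧
      ∑ i, μ i * β i ≤ r := by
  obtain ⟨t, ht, hq⟩ := exists_nonneg_combination_vec
    (fun o : Option (Fin k) => o.elim ((0 : Fin n → ℝ), (1 : ℝ)) fun i => (a i, β i))
    (-(Amap A ν), r) (by
      rintro ⟨z, s⟩ hz
      have hs : 0 ≤ s := by simpa [pairing_apply] using hz none
      have hzi : ∀ i, 0 ≤ dotp (a i) z + s * β i := fun i => by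
        simpa [pairing_apply, dotp, mul_comm] using hz (some i)
      obtain ⟨x₀, hx₀⟩ := hX
      have hgoal : pairing (-(Amap A ν), r) (z, s) = dotp (-(Amap A ν)) z + s * r := by
        simp [pairing_apply, dotp, mul_comm]
      rw [hgoal]
      by_contra! hneg
      have hdot : ∀ (y : Fin n → ℝ) (c T : ℝ),
          dotp y (c • (x₀ - T • z)) = c * (dotp y x₀ - T * dotp y z) := by
        intro y c T
        simp only [dotp, Pi.smul_apply, Pi.sub_apply, smul_eq_mul, Finset.mul_sum,
          ← Finset.sum_sub_distrib]
        exact Finset.sum_congr rfl fun i _ => by ring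
      have key : ∀ T : ℝ, 0 ≤ T →
          dotp (-(Amap A ν)) x₀ - T * dotp (-(Amap A ν)) z ≤ r * (1 + T * s) := by
        intro T hT
        have hpos : 0 < 1 + T * s := by positivity
        rw [sigA_le_iff] at h
        have := h ((1 + T * s)⁻¹ • (x₀ - T • z)) (fun i => by
          rw [hdot, inv_mul_le_iff₀ hpos]
          nlinarith [hx₀ i, mul_nonneg hT (hzi i)])
        rwa [← dotp_Amap, hdot, inv_mul_le_iff₀ hpos, mul_comm (1 + T * s)] at this
      have h0 := key 0 le_rfl
      set D := dotp (-(Amap A ν)) z + s * r with hD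
      set E := r - dotp (-(Amap A ν)) x₀ with hE
      have hE0 : 0 ≤ E := by rw [hE]; linarith
      have := key ((E + 1) / (-D)) (div_nonneg (by linarith) (by linarith))
      have hT : (E + 1) / (-D) * D = -(E + 1) := by
        rw [div_neg, neg_mul, div_mul_cancel₀ _ hneg.ne]
      nlinarith)
  refine ⟨fun i => t (some i), fun i => ht _, fun j => ?_, ?_⟩
  · have := congrFun (congrArg Prod.fst hq) j
    simp only [Fintype.sum_option, Prod.fst_add, Prod.fst_sum] at this
    simpa using this.symm
  · have := congrArg Prod.snd hq
    simp only [Fintype.sum_option, Prod.snd_add, Prod.snd_sum] at this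
    have h0 := ht none
    simp at this
    linarith

theorem sigA_le_of_certificate {n m k : ℕ} {a : Fin k → Fin n → ℝ} {β : Fin k → ℝ}
    {A : Fin m → Fin n → ℝ} {ν : Fin m → ℝ} {μ : Fin k → ℝ} (hμ : ∀ i, 0 ≤ μ i)
    (hμν : ∀ j, ∑ i, μ i * a i j = -(Amap A ν) j) :
    sigA {x | ∀ i, dotp (a i) x ≤ β i} A ν ≤ ((∑ i, μ i * β i : ℝ) : EReal) := by
  rw [sigA_le_iff]
  intro x hx
  rw [← dotp_Amap]
  calc dotp (-(Amap A ν)) x = ∑ i, μ i * dotp (a i) x := by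
        simp only [dotp, Pi.neg_apply, ← hμν, Finset.sum_mul, Finset.mul_sum]
        rw [Finset.sum_comm]
        simp only [mul_assoc]
    _ ≤ ∑ i, μ i * β i :=
        Finset.sum_le_sum fun i _ => mul_le_mul_of_nonneg_left (hx i) (hμ i)

/-! ### Circuits -/

theorem eq_zero_of_mem_Nbeta {m : ℕ} {b : Fin m} {ν : Fin m → ℝ} (h : ν ∈ Nbeta b)
    (hz : ∀ i, i ≠ b → ν i = 0) : ν = 0 := by
  have hb := h.2
  rw [Finset.sum_eq_single b (fun i _ hi => hz i hi) (by simp)] at hb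
  funext i
  by_cases hi : i = b
  · rw [hi, hb]; rfl
  · exact hz i hi

theorem nonneg_of_smul_mem_Nbeta {m : ℕ} {b : Fin m} {ν : Fin m → ℝ} (h : ν ∈ Nbeta b)
    (h0 : ν ≠ 0) {a : ℝ} (ha : a • ν ∈ Nbeta b) : 0 ≤ a := by
  by_contra! hneg
  refine h0 (eq_zero_of_mem_Nbeta h fun i hi => le_antisymm ?_ (h.1 i hi))
  have : 0 ≤ a * ν i := ha.1 i hi
  exact nonpos_of_mul_nonneg_right this hneg

theorem smul_mem_Nbeta {m : ℕ} {b : Fin m} {ν : Fin m → ℝ} (h : ν ∈ Nbeta b) {a : ℝ}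
    (ha : 0 ≤ a) : a • ν ∈ Nbeta b :=
  ⟨fun i hi => mul_nonneg ha (h.1 i hi), by
    simp only [Pi.smul_apply, smul_eq_mul, ← Finset.mul_sum, h.2, mul_zero]⟩

/-- A circuit only splits into multiples of itself along directions where `σ_X(-𝒜ν)` is
additive. -/
theorem IsXCircuit.eq_smul_of_add {n m : ℕ} {X : Set (Fin n → ℝ)} (hX : X.Nonempty)
    {A : Fin m → Fin n → ℝ} {b : Fin m} {l u w : Fin m → ℝ} (hl : IsXCircuit X A b l)
    (hu : u ∈ Nbeta b) (hw : w ∈ Nbeta b) (huw : l = u + w) {p q : ℝ} (hp : sigA X A u ≤ p)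
    (hq : sigA X A w ≤ q) (hpq : p + q ≤ (sigA X A l).toReal) :
    ∃ a : ℝ, 0 ≤ a ∧ u = a • l := by
  obtain ⟨hlN, hl0, hlt, hlc⟩ := hl
  suffices ∃ a : ℝ, u = a • l by
    obtain ⟨a, rfl⟩ := this
    exact ⟨a, nonneg_of_smul_mem_Nbeta hlN hl0 hu, rfl⟩
  have hprop : Proportional ((2 : ℝ) • u) ((2 : ℝ) • w) := by
    by_contra hnp
    refine hlc ⟨(2 : ℝ) • u, (2 : ℝ) • w, 1 / 2, smul_mem_Nbeta hu zero_le_two,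
      smul_mem_Nbeta hw zero_le_two, hnp, by norm_num, ?_, ?_⟩
    · rw [huw, smul_smul, smul_smul]
      norm_num
    · have hP' := sigA_combination_le hp hp zero_le_two le_rfl
      have hQ' := sigA_combination_le hq hq zero_le_two le_rfl
      simp only [zero_smul, add_zero, zero_mul] at hP' hQ'
      obtain ⟨P, hP⟩ := exists_sigA_eq_coe hX hP'
      obtain ⟨Q, hQ⟩ := exists_sigA_eq_coe hX hQ'
      rw [hP, EReal.coe_le_coe_iff] at hP'
      rw [hQ, EReal.coe_le_coe_iff] at hQ'
      rintro t ⟨ht0, ht1⟩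
      have h1 := sigA_combination_le hP.le hQ.le ht0 (sub_nonneg.2 ht1)
      have h2 := sigA_combination_le hP.le hQ.le (sub_nonneg.2 ht1) ht0
      obtain ⟨c, hc⟩ := exists_sigA_eq_coe hX h1
      obtain ⟨c', hc'⟩ := exists_sigA_eq_coe hX h2
      have h3 := sigA_combination_le hc.le hc'.le (s := 1 / 2) (t := 1 / 2) (by norm_num)
        (by norm_num)
      have hsum : (1 / 2 : ℝ) • (t • (2 : ℝ) • u + (1 - t) • (2 : ℝ) • w)
          + (1 / 2 : ℝ) • ((1 - t) • (2 : ℝ) • u + t • (2 : ℝ) • w) = l := by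
        rw [huw]
        module
      rw [hsum, ← coe_toReal_sigA hX hlt, EReal.coe_le_coe_iff] at h3
      rw [hc, EReal.coe_le_coe_iff] at h1
      rw [hc', EReal.coe_le_coe_iff] at h2
      rw [hc, hP, hQ]
      norm_cast
      linarith
  have hcancel : ∀ {x y : Fin m → ℝ} {t : ℝ}, (2 : ℝ) • x = t • (2 : ℝ) • y → x = t • y := by
    intro x y t h
    rw [smul_comm] at h
    exact smul_right_injective _ (two_ne_zero (α := ℝ)) h
  obtain ⟨t, ht | ht⟩ := hprop
  · replace ht := hcancel ht
    have hlw : l = (t + 1) • w := by rw [huw, ht]; module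
    have ht1 : t + 1 ≠ 0 := fun h => hl0 (by rw [hlw, h, zero_smul])
    refine ⟨t / (t + 1), ?_⟩
    rw [ht, hlw, smul_smul, div_mul_cancel₀ _ ht1]
  · replace ht := hcancel ht
    have hlu : l = (t + 1) • u := by rw [huw, ht]; module
    have ht1 : t + 1 ≠ 0 := fun h => hl0 (by rw [hlu, h, zero_smul])
    refine ⟨1 / (t + 1), ?_⟩
    rw [hlu, smul_smul, div_mul_cancel₀ _ ht1, one_smul]

open Filter Topology in
theorem eventually_mul_le_of_eq_zero_imp {u v : ℝ} (hu : 0 ≤ u) (huv : u = 0 → v = 0) :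
    ∀ᶠ ε in 𝓝[>] (0 : ℝ), ε * v ≤ u := by
  rcases hu.eq_or_lt with h | h
  · simp [huv h.symm, ← h]
  · have : Tendsto (fun ε : ℝ => ε * v) (𝓝[>] 0) (𝓝 0) := by
      have : Tendsto (fun ε : ℝ => ε * v) (𝓝 0) (𝓝 (0 * v)) :=
        (continuous_id.mul continuous_const).tendsto 0
      rw [zero_mul] at this
      exact this.mono_left nhdsWithin_le_nhds
    exact (this.eventually (gt_mem_nhds h)).mono fun _ h => h.le

open Filter Topology in
/-- A polyhedron has only finitely many normalized circuits: a circuit is determined by its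
negative index together with the support of itself and of a dual certificate. -/
theorem finite_Lambda {n m : ℕ} {X : Set (Fin n → ℝ)} (hX : X.Nonempty)
    (hpoly : IsPolyhedron X) (A : Fin m → Fin n → ℝ) : (Lambda X A).Finite := by
  classical
  obtain ⟨k, a, β, rfl⟩ := hpoly
  set X := {x : Fin n → ℝ | ∀ i, dotp (a i) x ≤ β i}
  have hex : ∀ l ∈ Lambda X A, ∃ (b : Fin m) (μ : Fin k → ℝ), (IsXCircuit X A b l ∧ l b = -1) ∧
      (∀ i, 0 ≤ μ i) ∧ (∀ j, ∑ i, μ i * a i j = -(Amap A l) j) ∧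
      ∑ i, μ i * β i ≤ (sigA X A l).toReal := by
    intro l hl
    obtain ⟨b, hb⟩ := Set.mem_iUnion.1 hl
    obtain ⟨μ, hμ⟩ := exists_dual_certificate a β hX A l _ (coe_toReal_sigA hX hb.1.2.2.1).ge
    exact ⟨b, μ, hb, hμ⟩
  rcases (Lambda X A).eq_empty_or_nonempty with hempty | ⟨l₁, hl₁⟩
  · simp [hempty]
  have : Nonempty (Fin m) := (hex l₁ hl₁).nonempty
  choose! b hb using hex
  choose! μ hb hμ hμl hμβ using hb
  refine Set.Finite.of_finite_image (f := fun l => (b l, Finset.univ.filter fun i => l i = 0,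
    Finset.univ.filter fun i => μ l i = 0)) (Set.toFinite _) ?_
  intro l hl l' hl' heq
  simp only [Prod.mk.injEq] at heq
  obtain ⟨hbb, hsupp, hsuppμ⟩ := heq
  replace hsupp : ∀ i, l i = 0 → l' i = 0 := fun i hi => by
    simpa using hsupp.subset (by simpa using hi)
  replace hsuppμ : ∀ i, μ l i = 0 → μ l' i = 0 := fun i hi => by
    simpa using hsuppμ.subset (by simpa using hi)
  obtain ⟨hc, hlb⟩ := hb l hl
  obtain ⟨hc', hlb'⟩ := hb l' hl'
  rw [← hbb] at hc' hlb'
  have h1 : ∀ᶠ ε in 𝓝[>] (0 : ℝ), ∀ i, i ≠ b l → ε * l' i ≤ l i := by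
    refine eventually_all.2 fun i => ?_
    by_cases hi : i = b l
    · simp [hi]
    · exact (eventually_mul_le_of_eq_zero_imp (hc.1.1 i hi) (hsupp i)).mono fun ε h _ => h
  have h2 : ∀ᶠ ε in 𝓝[>] (0 : ℝ), ∀ i, ε * μ l' i ≤ μ l i :=
    eventually_all.2 fun i => eventually_mul_le_of_eq_zero_imp (hμ l hl i) (hsuppμ i)
  obtain ⟨ε, ⟨hε1, hε2⟩, hε⟩ := ((h1.and h2).and self_mem_nhdsWithin).exists
  replace hε : 0 < ε := hε
  have hAmap : ∀ j, Amap A (l - ε • l') j = Amap A l j - ε * Amap A l' j := fun j => by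
    simp only [Amap, Pi.sub_apply, Pi.smul_apply, smul_eq_mul, sub_mul, Finset.sum_sub_distrib,
      Finset.mul_sum, mul_assoc]
  have hAmap' : ∀ j, Amap A (ε • l') j = ε * Amap A l' j := fun j => by
    simp only [Amap, Pi.smul_apply, smul_eq_mul, Finset.mul_sum, mul_assoc]
  have hu := sigA_le_of_certificate (β := β) (A := A) (ν := ε • l') (μ := ε • μ l') (a := a)
    (fun i => mul_nonneg hε.le (hμ l' hl' i)) (fun j => by
      have := hμl l' hl' j
      simp only [hAmap', Pi.smul_apply, smul_eq_mul, mul_assoc,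
        ← Finset.mul_sum] at this ⊢
      rw [this]; ring)
  have hw := sigA_le_of_certificate (β := β) (A := A) (ν := l - ε • l') (μ := μ l - ε • μ l')
    (a := a) (fun i => sub_nonneg.2 (hε2 i)) (fun j => by
      have h := hμl l hl j
      have h' := hμl l' hl' j
      simp only [hAmap, Pi.sub_apply, Pi.smul_apply, smul_eq_mul, mul_assoc, sub_mul,
        Finset.sum_sub_distrib, ← Finset.mul_sum] at h h' ⊢
      rw [h, h']; ring)
  have hN : l - ε • l' ∈ Nbeta (b l) := by
    refine ⟨fun i hi => sub_nonneg.2 (hε1 i hi), ?_⟩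
    simp only [Pi.sub_apply, Pi.smul_apply, smul_eq_mul, Finset.sum_sub_distrib,
      ← Finset.mul_sum, hc.1.2, hc'.1.2]
    ring
  obtain ⟨t, -, ht⟩ := hc.eq_smul_of_add hX (smul_mem_Nbeta hc'.1 hε.le) hN (by abel) hu hw (by
    rw [← Finset.sum_add_distrib]
    refine le_trans (le_of_eq (Finset.sum_congr rfl fun i _ => ?_)) (hμβ l hl)
    simp only [Pi.sub_apply, Pi.smul_apply, smul_eq_mul]
    ring)
  have htε : t = ε := by
    have := congrFun ht (b l)
    simp only [Pi.smul_apply, smul_eq_mul, hlb, hlb'] at this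
    linarith
  rw [htε] at ht
  exact (smul_right_injective _ hε.ne' ht).symm

/-! ### Witness cones -/

theorem eq_of_eq_neg_one {m : ℕ} {b b' : Fin m} {l : Fin m → ℝ} (hl : l ∈ Nbeta b)
    (hb' : l b' = -1) : b' = b := by
  by_contra h
  have := hl.1 b' h
  linarith

theorem filter_pos_subset_erase {m : ℕ} {b : Fin m} {l : Fin m → ℝ} (hlb : l b = -1) :
    Finset.univ.filter (fun i => 0 < l i) ⊆ Finset.univ.erase b := fun i hi => by
  refine Finset.mem_erase.2 ⟨fun h => ?_, Finset.mem_univ i⟩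
  rw [Finset.mem_filter, h, hlb] at hi
  linarith [hi.2]

theorem sum_filter_pos_mul {m : ℕ} {b : Fin m} {l : Fin m → ℝ} (hl : l ∈ Nbeta b)
    (hlb : l b = -1) (y : Fin m → ℝ) :
    ∑ i ∈ Finset.univ.filter (fun i => 0 < l i), y i * l i = (∑ i, y i * l i) + y b := by
  rw [← Finset.add_sum_erase _ _ (Finset.mem_univ b), hlb,
    Finset.sum_subset (filter_pos_subset_erase hlb)]
  · ring
  · intro i hi hi'
    have h1 := hl.1 i (Finset.ne_of_mem_erase hi)
    have : l i = 0 := le_antisymm (by simpa using hi') h1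
    rw [this, mul_zero]

theorem sum_filter_pos {m : ℕ} {b : Fin m} {l : Fin m → ℝ} (hl : l ∈ Nbeta b)
    (hlb : l b = -1) : ∑ i ∈ Finset.univ.filter (fun i => 0 < l i), l i = 1 := by
  simpa [hl.2] using sum_filter_pos_mul hl hlb (fun _ => 1)

/-- Coefficients in a witness cone pair nonnegatively with `exp y` if `φ_λ(y) ≥ 0`. -/
theorem WitnessCone.sum_mul_exp_nonneg {n m : ℕ} {X : Set (Fin n → ℝ)} {A : Fin m → Fin n → ℝ}
    {b : Fin m} {l c y : Fin m → ℝ} (hl : l ∈ Nbeta b) (hlb : l b = -1)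
    (hc : c ∈ WitnessCone X A b l) (hy : 0 ≤ phiFun X A l y) :
    0 ≤ ∑ i, c i * Real.exp (y i) := by
  obtain ⟨hc0, hcw⟩ := hc
  rw [← Finset.add_sum_erase _ _ (Finset.mem_univ b)]
  set P := Finset.univ.filter (fun i => 0 < l i) with hP
  have hcP : ∀ i ∈ P, 0 ≤ c i := fun i hi =>
    hc0 i (Finset.ne_of_mem_erase (filter_pos_subset_erase hlb hi))
  have hlP : ∀ i ∈ P, 0 < l i := fun i hi => (Finset.mem_filter.1 hi).2
  have h1 : ∑ i ∈ P, c i * Real.exp (y i) ≤ ∑ i ∈ Finset.univ.erase b, c i * Real.exp (y i) :=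
    Finset.sum_le_sum_of_subset_of_nonneg (filter_pos_subset_erase hlb) fun i hi _ =>
      mul_nonneg (hc0 i (Finset.ne_of_mem_erase hi)) (Real.exp_pos _).le
  have h2 := Real.geom_mean_le_arith_mean_weighted P l (fun i => c i / l i * Real.exp (y i))
    (fun i hi => (hlP i hi).le) (sum_filter_pos hl hlb)
    (fun i hi => mul_nonneg (div_nonneg (hcP i hi) (hlP i hi).le) (Real.exp_pos _).le)
  have h3 : ∑ i ∈ P, l i * (c i / l i * Real.exp (y i)) = ∑ i ∈ P, c i * Real.exp (y i) :=
    Finset.sum_congr rfl fun i hi => by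
      have := (hlP i hi).ne'
      field_simp
  have h4 : ∏ i ∈ P, (c i / l i * Real.exp (y i)) ^ l i
      = (∏ i ∈ P, (c i / l i) ^ l i) * Real.exp ((∑ i, y i * l i) + y b) := by
    rw [← sum_filter_pos_mul hl hlb, Real.exp_sum, ← Finset.prod_mul_distrib]
    refine Finset.prod_congr rfl fun i hi => ?_
    rw [Real.mul_rpow (div_nonneg (hcP i hi) (hlP i hi).le) (Real.exp_pos _).le, Real.exp_mul]
  rw [h3, h4] at h2
  rcases le_or_gt 0 (c b) with hcb | hcb
  · have := Finset.sum_nonneg fun i hi => mul_nonneg (hcP i hi) (Real.exp_pos (y i)).le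
    have := mul_nonneg hcb (Real.exp_pos (y b)).le
    linarith
  · have h5 := mul_le_mul_of_nonneg_right hcw (Real.exp_pos ((∑ i, y i * l i) + y b)).le
    rw [mul_assoc, ← Real.exp_add] at h5
    have h6 : Real.exp (y b) ≤ Real.exp ((sigA X A l).toReal + ((∑ i, y i * l i) + y b)) := by
      rw [Real.exp_le_exp]
      unfold phiFun at hy
      linarith
    have h7 := mul_le_mul_of_nonneg_left h6 (neg_pos.2 hcb).le
    linarith

theorem phiFun_dotp_nonneg {n m : ℕ} {X : Set (Fin n → ℝ)} (hX : X.Nonempty)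
    {A : Fin m → Fin n → ℝ} {l : Fin m → ℝ} (hl : sigA X A l < ⊤) {x : Fin n → ℝ} (hx : x ∈ X) :
    0 ≤ phiFun X A l fun i => dotp (A i) x := by
  have := sigA_le_iff.1 (coe_toReal_sigA hX hl).ge x hx
  simp only [phiFun, mul_comm (dotp _ _)]
  linarith

theorem WitnessCone_subset_AgeCone {n m : ℕ} {X : Set (Fin n → ℝ)} (hX : X.Nonempty)
    {A : Fin m → Fin n → ℝ} {b : Fin m} {l : Fin m → ℝ} (hl : l ∈ LambdaB X A b) :
    WitnessCone X A b l ⊆ AgeCone X A b := fun _ hc =>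
  ⟨hc.1, fun _ hx => WitnessCone.sum_mul_exp_nonneg hl.1.1 hl.2 hc
    (phiFun_dotp_nonneg hX hl.1.2.2.1 hx)⟩

theorem AgeCone_zero_mem {n m : ℕ} (X : Set (Fin n → ℝ)) (A : Fin m → Fin n → ℝ) (b : Fin m) :
    (0 : Fin m → ℝ) ∈ AgeCone X A b :=
  ⟨fun _ _ => le_rfl, fun x _ => by simp⟩

theorem AgeCone_add_mem {n m : ℕ} {X : Set (Fin n → ℝ)} {A : Fin m → Fin n → ℝ} {b : Fin m}
    {c d : Fin m → ℝ} (hc : c ∈ AgeCone X A b) (hd : d ∈ AgeCone X A b) :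
    c + d ∈ AgeCone X A b :=
  ⟨fun i hi => add_nonneg (hc.1 i hi) (hd.1 i hi), fun x hx => by
    simpa only [Pi.add_apply, add_mul, Finset.sum_add_distrib] using
      add_nonneg (hc.2 x hx) (hd.2 x hx)⟩

theorem Sage_zero_mem {n m : ℕ} (X : Set (Fin n → ℝ)) (A : Fin m → Fin n → ℝ) :
    (0 : Fin m → ℝ) ∈ Sage X A :=
  ⟨0, fun b => AgeCone_zero_mem X A b, by simp⟩

theorem Sage_add_mem {n m : ℕ} {X : Set (Fin n → ℝ)} {A : Fin m → Fin n → ℝ}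
    {c d : Fin m → ℝ} (hc : c ∈ Sage X A) (hd : d ∈ Sage X A) : c + d ∈ Sage X A := by
  obtain ⟨f, hf, rfl⟩ := hc
  obtain ⟨g, hg, rfl⟩ := hd
  exact ⟨f + g, fun b => AgeCone_add_mem (hf b) (hg b), by simp [Finset.sum_add_distrib]⟩

theorem AgeCone_subset_Sage {n m : ℕ} (X : Set (Fin n → ℝ)) (A : Fin m → Fin n → ℝ) (b : Fin m) :
    AgeCone X A b ⊆ Sage X A := fun c hc => by
  refine ⟨Pi.single b c, fun b' => ?_, by simp⟩
  by_cases h : b' = b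
  · subst h
    simpa using hc
  · rw [Pi.single_eq_of_ne h]
    exact AgeCone_zero_mem X A b'

theorem WitnessConeL_subset_WitnessCone {n m : ℕ} {X : Set (Fin n → ℝ)} {A : Fin m → Fin n → ℝ}
    {b : Fin m} {l : Fin m → ℝ} (hl : l ∈ LambdaB X A b) :
    WitnessConeL X A l ⊆ WitnessCone X A b l := fun c hc => by
  obtain ⟨b', hb', hc⟩ := Set.mem_iUnion₂.1 hc
  rwa [eq_of_eq_neg_one hl.1.1 hb'] at hc

theorem WitnessConeL_subset_Sage {n m : ℕ} {X : Set (Fin n → ℝ)} (hX : X.Nonempty)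
    {A : Fin m → Fin n → ℝ} {l : Fin m → ℝ} (hl : l ∈ Lambda X A) :
    WitnessConeL X A l ⊆ Sage X A := by
  obtain ⟨b, hb⟩ := Set.mem_iUnion.1 hl
  exact (WitnessConeL_subset_WitnessCone hb).trans
    ((WitnessCone_subset_AgeCone hX hb).trans (AgeCone_subset_Sage X A b))

theorem MinkSumOver_subset_Sage {n m : ℕ} {X : Set (Fin n → ℝ)} (hX : X.Nonempty)
    {A : Fin m → Fin n → ℝ} {Λ : Set (Fin m → ℝ)} (hΛ : Λ ⊆ Lambda X A) :
    MinkSumOver Λ (WitnessConeL X A) ⊆ Sage X A := by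
  rintro c ⟨s, f, hs, hf, rfl⟩
  exact Finset.sum_induction _ (· ∈ Sage X A) (fun _ _ => Sage_add_mem) (Sage_zero_mem X A)
    fun l hl => WitnessConeL_subset_Sage hX (hΛ (hs hl)) (hf l hl)

/-- If `φ_λ(y) < 0`, some member of the witness cone of `λ` pairs negatively with `exp y`. -/
theorem exists_mem_WitnessConeL_sum_neg {n m : ℕ} {X : Set (Fin n → ℝ)} {A : Fin m → Fin n → ℝ}
    {l y : Fin m → ℝ} (hl : l ∈ Lambda X A) (hy : phiFun X A l y < 0) :
    ∃ c ∈ WitnessConeL X A l, ∑ i, c i * Real.exp (y i) < 0 := by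
  classical
  obtain ⟨b, hlc, hlb⟩ := Set.mem_iUnion.1 hl
  have hlN := hlc.1
  set S := (sigA X A l).toReal with hS
  set Q := (∑ i, y i * l i) + y b with hQ
  let c : Fin m → ℝ := fun i => if i = b then -Real.exp (-Q - S) else l i * Real.exp (-y i)
  have hcb : c b = -Real.exp (-Q - S) := if_pos rfl
  have hci : ∀ i, i ≠ b → c i = l i * Real.exp (-y i) := fun i hi => if_neg hi
  refine ⟨c, Set.mem_iUnion₂.2 ⟨b, hlb, fun i hi => ?_, le_of_eq ?_⟩, ?_⟩
  · rw [hci i hi]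
    exact mul_nonneg (hlN.1 i hi) (Real.exp_pos _).le
  · rw [hcb, neg_neg, ← Real.exp_add]
    have : ∏ i ∈ Finset.univ.filter (fun i => 0 < l i), (c i / l i) ^ l i
        = ∏ i ∈ Finset.univ.filter (fun i => 0 < l i), Real.exp (-(y i * l i)) := by
      refine Finset.prod_congr rfl fun i hi => ?_
      have hpos := (Finset.mem_filter.1 hi).2
      rw [hci i (Finset.ne_of_mem_erase (filter_pos_subset_erase hlb hi)),
        mul_div_cancel_left₀ _ hpos.ne', ← Real.exp_mul, neg_mul]
    rw [this, ← Real.exp_sum, Finset.sum_neg_distrib, sum_filter_pos_mul hlN hlb, ← hQ]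
    congr 1
    ring
  · rw [← Finset.add_sum_erase _ _ (Finset.mem_univ b), hcb]
    have h1 : ∑ i ∈ Finset.univ.erase b, c i * Real.exp (y i) = 1 := by
      have h2 := hlN.2
      rw [← Finset.add_sum_erase _ _ (Finset.mem_univ b), hlb] at h2
      have : ∑ i ∈ Finset.univ.erase b, c i * Real.exp (y i) = ∑ i ∈ Finset.univ.erase b, l i :=
        Finset.sum_congr rfl fun i hi => by
          rw [hci i (Finset.ne_of_mem_erase hi), mul_assoc, ← Real.exp_add, neg_add_cancel,
            Real.exp_zero, mul_one]
      linarith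
    rw [h1, neg_mul, ← Real.exp_add]
    have : 1 < Real.exp (-Q - S + y b) := by
      rw [Real.one_lt_exp_iff]
      unfold phiFun at hy
      linarith
    linarith

/-! ### Separating a reduced circuit -/

theorem coneHull_smul_mem {E : Type*} [AddCommMonoid E] [Module ℝ E] {S : Set E} {v : E}
    (hv : v ∈ S) {t : ℝ} (ht : 0 ≤ t) : t • v ∈ coneHull S :=
  ⟨1, fun _ => t, fun _ => v, fun _ => ht, fun _ => hv, by simp⟩

theorem coneHull_sum_mem {E ι : Type*} [AddCommMonoid E] [Module ℝ E] {S : Set E}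
    (s : Finset ι) (t : ι → ℝ) (v : ι → E) (ht : ∀ i, 0 ≤ t i) (hv : ∀ i, v i ∈ S) :
    ∑ i ∈ s, t i • v i ∈ coneHull S :=
  ⟨s.card, fun j => t (s.equivFin.symm j), fun j => v (s.equivFin.symm j), fun _ => ht _,
    fun _ => hv _, by
      rw [← Finset.sum_coe_sort s, ← s.equivFin.symm.sum_comp]⟩

/-- Normalized circuits that are proportional by a nonzero factor coincide. -/
theorem eq_of_smul_eq_smul {n m : ℕ} {X : Set (Fin n → ℝ)} {A : Fin m → Fin n → ℝ}
    {l l' : Fin m → ℝ} (hl : l ∈ Lambda X A) (hl' : l' ∈ Lambda X A) {s t : ℝ} (ht : 0 < t)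
    (hs : 0 ≤ s) (h : t • l' = s • l) : l' = l := by
  obtain ⟨b, hlc, hlb⟩ := Set.mem_iUnion.1 hl
  obtain ⟨b', hlc', hlb'⟩ := Set.mem_iUnion.1 hl'
  have hi : ∀ i, t * l' i = s * l i := fun i => congrFun h i
  have hbb : b' = b := by
    by_contra hne
    have h1 := hi b'
    have h2 := mul_nonneg hs (hlc.1.1 b' hne)
    rw [hlb'] at h1
    linarith
  have hst : t = s := by
    have := hi b
    rw [hlb, ← hbb, hlb'] at this
    linarith
  rw [hst] at h
  exact smul_right_injective _ (hst ▸ ht).ne' h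

/-- A reduced circuit is separated from any family of other circuits. -/
theorem exists_separating_phiFun {n m : ℕ} {X : Set (Fin n → ℝ)} (hX : X.Nonempty)
    (hpoly : IsPolyhedron X) {A : Fin m → Fin n → ℝ} {Λ : Set (Fin m → ℝ)}
    (hΛ : Λ ⊆ Lambda X A) {l₀ : Fin m → ℝ} (hl₀ : l₀ ∈ LambdaStar X A) (hnot : l₀ ∉ Λ) :
    ∃ y, (∀ l ∈ Λ, 0 ≤ phiFun X A l y) ∧ phiFun X A l₀ y < 0 := by
  classical
  have hfin : Finite Λ := ((finite_Lambda hX hpoly A).subset hΛ).to_subtype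
  have := Fintype.ofFinite Λ
  have hphi : ∀ l (z : (Fin m → ℝ) × ℝ), pairing (phiVec X A l) z =
      (∑ i, z.1 i * l i) + z.2 * (sigA X A l).toReal := fun _ _ => rfl
  let gen : Option Λ → (Fin m → ℝ) × ℝ :=
    fun o => o.elim ((0 : Fin m → ℝ), (1 : ℝ)) fun l => phiVec X A l
  obtain ⟨z, hz, hz₀⟩ : ∃ z, (∀ o, 0 ≤ pairing (gen o) z) ∧
      pairing (phiVec X A l₀) z < 0 := by
    by_contra! hcon
    obtain ⟨t, ht, hsum⟩ := exists_nonneg_combination_vec gen (phiVec X A l₀) hcon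
    have hgen : ∀ o, gen o ∈ (phiVec X A '' Lambda X A) ∪ {((0 : Fin m → ℝ), (1 : ℝ))} := by
      rintro (_ | l)
      · exact Or.inr rfl
      · exact Or.inl ⟨l, hΛ l.2, rfl⟩
    have hmul : ∀ o, ∃ s : ℝ, 0 ≤ s ∧ t o • gen o = s • phiVec X A l₀ := fun o =>
      (hl₀.2.2.2 _ (coneHull_smul_mem (hgen o) (ht o)) _
        (coneHull_sum_mem (Finset.univ.erase o) t gen ht hgen)
        (by rw [hsum]; exact (Finset.add_sum_erase _ (fun o => t o • gen o) (Finset.mem_univ o)).symm)).1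
    have hzero : ∀ l : Λ, t (some l) = 0 := by
      intro l
      by_contra hne
      obtain ⟨s, hs, h⟩ := hmul (some l)
      refine hnot (?_ : l₀ ∈ Λ)
      rw [← eq_of_smul_eq_smul hl₀.1 (hΛ l.2) ((ht _).lt_of_ne' hne) hs (congrArg Prod.fst h)]
      exact l.2
    obtain ⟨b, hlc, -⟩ := Set.mem_iUnion.1 hl₀.1
    refine hlc.2.1 ?_
    have := congrArg Prod.fst hsum
    rw [Fintype.sum_option] at this
    simpa [hzero, gen, phiVec] using this
  obtain ⟨x, hx⟩ := hX
  have hz2 : 0 ≤ z.2 := by simpa [gen, pairing_apply] using hz none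
  have hfinite : ∀ l ∈ Lambda X A, 0 ≤ phiFun X A l fun i => dotp (A i) x := fun l hl => by
    obtain ⟨b, hlc, -⟩ := Set.mem_iUnion.1 hl
    exact phiFun_dotp_nonneg ⟨x, hx⟩ hlc.2.2.1 hx
  set D := pairing (phiVec X A l₀) z with hD
  set E := phiFun X A l₀ fun i => dotp (A i) x with hE
  set T := (E + 1) / (-D) with hT
  have hE0 : 0 ≤ E := hfinite l₀ hl₀.1
  have hT0 : 0 ≤ T := div_nonneg (by linarith) (by linarith)
  have hTD : T * D = -(E + 1) := by
    rw [hT, div_neg, neg_mul, div_mul_cancel₀ _ hz₀.ne]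
  have hpos : 0 < 1 + T * z.2 := by positivity
  have hcomb : ∀ l, phiFun X A l ((1 + T * z.2)⁻¹ • ((fun i => dotp (A i) x) + T • z.1)) =
      (1 + T * z.2)⁻¹ *
        ((phiFun X A l fun i => dotp (A i) x) + T * pairing (phiVec X A l) z) := by
    intro l
    have : ∑ i, ((1 + T * z.2)⁻¹ • ((fun i => dotp (A i) x) + T • z.1)) i * l i
        = (1 + T * z.2)⁻¹ * ((∑ i, dotp (A i) x * l i) + T * ∑ i, z.1 i * l i) := by
      simp only [Pi.smul_apply, Pi.add_apply, smul_eq_mul, Finset.mul_sum,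
        ← Finset.sum_add_distrib]
      exact Finset.sum_congr rfl fun i _ => by ring
    simp only [phiFun, hphi, this]
    field_simp
    ring
  refine ⟨(1 + T * z.2)⁻¹ • ((fun i => dotp (A i) x) + T • z.1), fun l hl => ?_, ?_⟩
  · rw [hcomb]
    exact mul_nonneg (inv_pos.2 hpos).le
      (add_nonneg (hfinite l (hΛ hl)) (mul_nonneg hT0 (hz (some ⟨l, hl⟩))))
  · rw [hcomb, ← hD, hTD]
    exact mul_neg_of_pos_of_neg (inv_pos.2 hpos) (by linarith)

theorem statement11 {n m : ℕ} (X : Set (Fin n → ℝ)) (hXne : X.Nonempty)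
    (hpoly : IsPolyhedron X)
    (A : Fin m → Fin n → ℝ) (hA : Function.Injective A) (hm : 0 < m)
    (hLI : ExpLinIndep X A) (hL : (Lambda X A).Nonempty)
    (Λ : Set (Fin m → ℝ)) (hsub : Λ ⊆ LambdaStar X A) (hne : Λ ≠ LambdaStar X A) :
    MinkSumOver Λ (WitnessConeL X A) ⊂ Sage X A := by
  have hΛ : Λ ⊆ Lambda X A := fun l hl => (hsub hl).1
  refine ⟨MinkSumOver_subset_Sage hXne hΛ, fun hle => ?_⟩
  obtain ⟨l₀, hl₀, hnot⟩ := Set.exists_of_ssubset (hsub.ssubset_of_ne hne)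
  obtain ⟨y, hy, hy₀⟩ := exists_separating_phiFun hXne hpoly hΛ hl₀ hnot
  obtain ⟨c, hc, hneg⟩ := exists_mem_WitnessConeL_sum_neg hl₀.1 hy₀
  obtain ⟨s, f, hs, hf, rfl⟩ := hle (WitnessConeL_subset_Sage hXne hl₀.1 hc)
  refine hneg.not_ge ?_
  simp only [Finset.sum_apply, Finset.sum_mul]
  rw [Finset.sum_comm]
  refine Finset.sum_nonneg fun l hl => ?_
  obtain ⟨b, hb⟩ := Set.mem_iUnion.1 (hΛ (hs hl))
  exact WitnessCone.sum_mul_exp_nonneg hb.1.1 hb.2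
    (WitnessConeL_subset_WitnessCone hb (hf l hl)) (hy l (hs hl))
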